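/- Let m ≥ 1, let B₁, …, B_m be Bernstein subsets of ℝ, and let V₁, …, V_m be open subsets of the Sorgenfrey plane S × S such that (x, −x) ∈ V_i for every x ∈ B_i and every i. Then there exist a positive integer k and real numbers a < b such that for every i ∈ {1, …, m} the set {x ∈ B_i : [x, x + 1/k) × [−x, −x + 1/k) ⊆ V_i} ∩ (a, b) is dense in (a, b) with respect to the Euclidean topology of ℝ. -/

import Mathlib

/-- The Sorgenfrey topology on `ℝ`: generated by the half-open intervals `[a, b)`. -/
def sorgenfreyLine : TopologicalSpace ℝ :=
  TopologicalSpace.generateFrom {s : Set ℝ | ∃ a b : ℝ, s = Set.Ico a b}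

/-- The Sorgenfrey plane topology on `ℝ × ℝ`: the product of two copies of the
Sorgenfrey topology. -/
def sorgenfreyPlane : TopologicalSpace (ℝ × ℝ) :=
  TopologicalSpace.induced Prod.fst sorgenfreyLine ⊓
    TopologicalSpace.induced Prod.snd sorgenfreyLine

/-- A Bernstein set: both `B` and its complement meet every uncountable closed
(in the Euclidean topology) subset of `ℝ`. -/
def IsBernstein (B : Set ℝ) : Prop :=
  ∀ C : Set ℝ, IsClosed C → ¬C.Countable → (B ∩ C).Nonempty ∧ (Bᶜ ∩ C).Nonempty

/-- Auxiliary finer description of the Sorgenfrey plane by half-open squares. -/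
def squareTop : TopologicalSpace (ℝ × ℝ) where
  IsOpen U := ∀ p ∈ U, ∃ e : ℝ, 0 < e ∧
    Set.Ico p.1 (p.1 + e) ×ˢ Set.Ico p.2 (p.2 + e) ⊆ U
  isOpen_univ := fun p _ => ⟨1, one_pos, Set.subset_univ _⟩
  isOpen_inter := by
    intro s t hs ht p hp
    obtain ⟨e, he, h1⟩ := hs p hp.1
    obtain ⟨d, hd, h2⟩ := ht p hp.2
    refine ⟨min e d, lt_min he hd, fun q hq => ⟨h1 ?_, h2 ?_⟩⟩
    · simp only [Set.mem_prod, Set.mem_Ico] at hq ⊢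
      have := min_le_left e d
      exact ⟨⟨hq.1.1, by linarith [hq.1.2]⟩, hq.2.1, by linarith [hq.2.2]⟩
    · simp only [Set.mem_prod, Set.mem_Ico] at hq ⊢
      have := min_le_right e d
      exact ⟨⟨hq.1.1, by linarith [hq.1.2]⟩, hq.2.1, by linarith [hq.2.2]⟩
  isOpen_sUnion := by
    intro S hS p hp
    obtain ⟨t, ht, hpt⟩ := hp
    obtain ⟨e, he, h⟩ := hS t ht p hpt
    exact ⟨e, he, h.trans (Set.subset_sUnion_of_mem ht)⟩

lemma squareTop_le : squareTop ≤ sorgenfreyPlane := by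
  refine le_inf ?_ ?_
  · rw [← continuous_iff_le_induced]
    refine continuous_generateFrom_iff.2 ?_
    rintro s ⟨a, b, rfl⟩ p hp
    have hp' : a ≤ p.1 ∧ p.1 < b := hp
    refine ⟨b - p.1, by linarith [hp'.2], fun q hq => ?_⟩
    simp only [Set.mem_prod, Set.mem_Ico] at hq
    exact ⟨by linarith [hq.1.1, hp'.1], by linarith [hq.1.2]⟩
  · rw [← continuous_iff_le_induced]
    refine continuous_generateFrom_iff.2 ?_
    rintro s ⟨a, b, rfl⟩ p hp
    have hp' : a ≤ p.2 ∧ p.2 < b := hp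
    refine ⟨b - p.2, by linarith [hp'.2], fun q hq => ?_⟩
    simp only [Set.mem_prod, Set.mem_Ico] at hq
    exact ⟨by linarith [hq.2.1, hp'.1], by linarith [hq.2.2]⟩

lemma bernstein_meets_borel {B : Set ℝ} (hB : IsBernstein B) {s : Set ℝ}
    (hs : MeasurableSet s) (hc : ¬ s.Countable) : (B ∩ s).Nonempty := by
  obtain ⟨f, hfs, hf', hinj⟩ : ∃ f : (ℕ → Bool) → ℝ, Set.range f ⊆ s ∧ Continuous f ∧
      Function.Injective f := by
    obtain ⟨t', ht', hpol, hcl, -⟩ := hs.isClopenable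
    obtain ⟨f, hfs, hf, hinj⟩ :=
      @IsClosed.exists_nat_bool_injection_of_not_countable ℝ t' hpol s hcl hc
    exact ⟨f, hfs, @continuous_le_rng _ _ _ _ _ _ ht' hf, hinj⟩
  obtain ⟨x, hx, hx'⟩ := (hB (Set.range f) (isCompact_range hf').isClosed (by
    intro h
    have h4 : Cardinal.mk (ℕ → Bool) = 2 ^ Cardinal.aleph0 := by simp
    have h2 : Countable (ℕ → Bool) := by
      have := h.to_subtype
      exact (Set.rangeFactorization_injective.2 hinj).countable
    have h3 : Cardinal.mk (ℕ → Bool) ≤ Cardinal.aleph0 := Cardinal.mk_le_aleph0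
    rw [h4] at h3
    exact absurd h3 (not_le.2 (Cardinal.cantor _)))).1
  exact ⟨x, hx, hfs hx'⟩

lemma bernstein_step {B : Set ℝ} (hB : IsBernstein B) (A : ℕ → Set ℝ)
    (hA : B ⊆ ⋃ k, A k) {a b : ℝ} (hab : a < b) :
    ∃ k, ∃ c d : ℝ, c < d ∧ Set.Ioo c d ⊆ Set.Ioo a b ∧ Set.Ioo c d ⊆ closure (A k) := by
  by_contra hcon
  push Not at hcon
  have hint : ∀ k, interior (closure (A k) ∩ Set.Icc a b) = ∅ := by
    intro k
    by_contra hne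
    obtain ⟨x, hx⟩ := Set.nonempty_iff_ne_empty.2 hne
    obtain ⟨c, d, hcx, hsub⟩ := mem_nhds_iff_exists_Ioo_subset.1
      (isOpen_interior.mem_nhds hx)
    have h1 := hsub.trans interior_subset
    refine hcon k c d (hcx.1.trans hcx.2) ?_ (fun y hy => (h1 hy).1)
    have h2 : Set.Ioo c d ⊆ interior (Set.Icc a b) :=
      interior_maximal (fun y hy => (h1 hy).2) isOpen_Ioo
    rwa [interior_Icc] at h2
  set G := Set.Ioo a b \ ⋃ k, closure (A k) with hG
  have hGm : MeasurableSet G :=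
    measurableSet_Ioo.diff (MeasurableSet.iUnion fun k => isClosed_closure.measurableSet)
  have hGc : ¬ G.Countable := by
    intro hc
    have h1 : ∀ k, (closure (A k) ∩ Set.Icc a b)ᶜ ∈ residual ℝ := fun k =>
      residual_of_dense_open (isClosed_closure.inter isClosed_Icc).isOpen_compl
        (interior_eq_empty_iff_dense_compl.1 (hint k))
    have h2 : ∀ x ∈ G, ({x}ᶜ : Set ℝ) ∈ residual ℝ := fun x _ =>
      residual_of_dense_open isOpen_compl_singleton (dense_compl_singleton x)
    have h3 := Filter.inter_mem (countable_iInter_mem.2 h1) ((countable_bInter_mem hc).2 h2)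
    obtain ⟨x, hx, hx1, hx2⟩ := (dense_of_mem_residual h3).inter_open_nonempty
      _ isOpen_Ioo (Set.nonempty_Ioo.2 hab)
    have hxG : x ∈ G := by
      refine ⟨hx, fun h => ?_⟩
      obtain ⟨k, hk⟩ := Set.mem_iUnion.1 h
      exact Set.mem_iInter.1 hx1 k ⟨hk, Set.Ioo_subset_Icc_self hx⟩
    exact Set.mem_iInter₂.1 hx2 x hxG rfl
  obtain ⟨x, hxB, hxG⟩ := bernstein_meets_borel hB hGm hGc
  obtain ⟨k, hk⟩ := Set.mem_iUnion.1 (hA hxB)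
  exact hxG.2 (Set.mem_iUnion.2 ⟨k, subset_closure hk⟩)

/-- If `B₁, …, B_m` (`m ≥ 1`) are Bernstein sets and `V₁, …, V_m` open subsets of the
Sorgenfrey plane with `(x,-x) ∈ Vᵢ` for all `x ∈ Bᵢ`, then there are `k ≥ 1` and `a < b`
such that for every `i` the set `{x ∈ Bᵢ : [x, x + 1/k) × [-x, -x + 1/k) ⊆ Vᵢ} ∩ (a, b)`
is dense in `(a, b)` for the Euclidean topology, i.e. its Euclidean closure is `[a, b]`. -/
theorem bernstein_common_dense_uniform_square (m : ℕ) (hm : 1 ≤ m)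
    (B : Fin m → Set ℝ) (hBern : ∀ i, IsBernstein (B i))
    (V : Fin m → Set (ℝ × ℝ)) (hVopen : ∀ i, sorgenfreyPlane.IsOpen (V i))
    (hBV : ∀ i, ∀ x ∈ B i, ((x, -x) : ℝ × ℝ) ∈ V i) :
    ∃ k : ℕ, 0 < k ∧ ∃ a b : ℝ, a < b ∧
      ∀ i, closure ({x ∈ B i |
          Set.Ico x (x + 1 / (k : ℝ)) ×ˢ Set.Ico (-x) (-x + 1 / (k : ℝ)) ⊆ V i}
        ∩ Set.Ioo a b) = Set.Icc a b := by
  classical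
  set A : Fin m → ℕ → Set ℝ := fun i k => {x ∈ B i |
          Set.Ico x (x + 1 / (k : ℝ)) ×ˢ Set.Ico (-x) (-x + 1 / (k : ℝ)) ⊆ V i} with hAdef
  have hmono : ∀ i (k l : ℕ), 0 < k → k ≤ l → A i k ⊆ A i l := by
    intro i k l hk hkl x hx
    refine ⟨hx.1, Set.Subset.trans ?_ hx.2⟩
    have hk' : (0 : ℝ) < k := by exact_mod_cast hk
    have : 1 / (l : ℝ) ≤ 1 / (k : ℝ) := one_div_le_one_div_of_le hk' (by exact_mod_cast hkl)
    exact Set.prod_mono (Set.Ico_subset_Ico_right (by linarith))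
      (Set.Ico_subset_Ico_right (by linarith))
  have hcov : ∀ i, B i ⊆ ⋃ k : ℕ, A i (k + 1) := by
    intro i x hx
    obtain ⟨e, he, hsub⟩ := squareTop_le (V i) (hVopen i) (x, -x) (hBV i x hx)
    obtain ⟨n, hn⟩ := exists_nat_one_div_lt he
    refine Set.mem_iUnion.2 ⟨n, hx, Set.Subset.trans ?_ hsub⟩
    push_cast
    exact Set.prod_mono (Set.Ico_subset_Ico_right (by linarith))
      (Set.Ico_subset_Ico_right (by linarith))
  have key : ∀ s : Finset (Fin m), ∃ k : ℕ, 0 < k ∧ ∃ a b : ℝ, a < b ∧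
      ∀ i ∈ s, Set.Ioo a b ⊆ closure (A i k) := by
    intro s
    induction s using Finset.induction_on with
    | empty => exact ⟨1, one_pos, 0, 1, one_pos, by simp⟩
    | insert j s hj ih =>
      obtain ⟨k, hk, a, b, hab, h⟩ := ih
      obtain ⟨l, c, d, hcd, hsub, hcl⟩ := bernstein_step (hBern j) _ (hcov j) hab
      refine ⟨max k (l + 1), lt_max_of_lt_left hk, c, d, hcd, fun i hi => ?_⟩
      rcases Finset.mem_insert.1 hi with rfl | hi
      · exact hcl.trans (closure_mono (hmono _ _ _ (Nat.succ_pos l) (le_max_right _ _)))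
      · exact (hsub.trans (h i hi)).trans
          (closure_mono (hmono _ _ _ hk (le_max_left _ _)))
  obtain ⟨k, hk, a, b, hab, h⟩ := key Finset.univ
  refine ⟨k, hk, a, b, hab, fun i => ?_⟩
  change closure (A i k ∩ Set.Ioo a b) = Set.Icc a b
  rw [← closure_Ioo hab.ne]
  refine Set.Subset.antisymm (closure_mono Set.inter_subset_right) ?_
  refine closure_minimal (fun x hx => ?_) isClosed_closure
  have := isOpen_Ioo.inter_closure ⟨hx, h i (Finset.mem_univ i) hx⟩
  rwa [Set.inter_comm] at this
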